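/- (Equality case of the relaxed triangle inequality for τ̂_x.) Let a, b, c be non-strict incomplete rankings of n objects and let W = V_a ∩ V_b ∩ V_c with |W| ≥ 2. Then τ̂_x(a|_W, b|_W) + τ̂_x(b|_W, c|_W) = τ̂_x(a|_W, c|_W) + 1 if and only if b|_W is between a|_W and c|_W, i.e., for every ordered pair (i,j) with i ≠ j and i, j ∈ W, if M(a)_{ij} = M(c)_{ij} then M(b)_{ij} = M(a)_{ij}. -/

import Mathlib

open Finset

/-- A non-strict incomplete ranking of `n` objects: object `i` is ranked iff `a i ≠ none`. -/
abbrev Ranking (n : ℕ) := Fin n → Option ℕ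

/-- The set of objects ranked by `a`. -/
def ranked {n : ℕ} (a : Ranking n) : Finset (Fin n) :=
  Finset.univ.filter fun i => (a i).isSome

/-- The ranking-matrix of `a`. -/
def rmat {n : ℕ} (a : Ranking n) (i j : Fin n) : ℤ :=
  if i = j then 0
  else
    match a i, a j with
    | some x, some y => if x ≤ y then 1 else -1
    | _, _ => 0

/-- `n̄(a,b)`: the number of objects ranked by both `a` and `b`. -/
def nbar {n : ℕ} (a b : Ranking n) : ℕ := (ranked a ∩ ranked b).card

/-- The scaled Kendall tau-extended correlation coefficient `τ̂ₓ(a,b)`. -/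
def tauHat {n : ℕ} (a b : Ranking n) : ℚ :=
  (∑ i : Fin n, ∑ j : Fin n, ((rmat a i j * rmat b i j : ℤ) : ℚ)) /
    ((nbar a b : ℚ) * ((nbar a b : ℚ) - 1))

/-- The Kendall tau-extended correlation coefficient `τₓ(a,b)` (extended ranking-matrix). -/
def tauX {n : ℕ} (a b : Ranking n) : ℚ :=
  (∑ i : Fin n, ∑ j : Fin n, ((rmat a i j * rmat b i j : ℤ) : ℚ)) /
    ((n : ℚ) * ((n : ℚ) - 1))

/-- The projected Kemeny–Snell distance (minimum distance unit 1/2). -/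
def dPKS {n : ℕ} (a b : Ranking n) : ℚ :=
  (1/4) * ∑ i ∈ ranked a ∩ ranked b, ∑ j ∈ ranked a ∩ ranked b,
    ((|(((a i).getD 0 : ℤ) - ((a j).getD 0 : ℤ)).sign -
       (((b i).getD 0 : ℤ) - ((b j).getD 0 : ℤ)).sign| : ℤ) : ℚ)

/-- The normalized projected Kemeny–Snell distance. -/
def dNPKS {n : ℕ} (a b : Ranking n) : ℚ :=
  if 2 ≤ nbar a b then
    dPKS a b / ((nbar a b : ℚ) * ((nbar a b : ℚ) - 1) / 2)
  else 0

/-- The projection of `a` onto the subset `S` of objects. -/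
def proj {n : ℕ} (a : Ranking n) (S : Finset (Fin n)) : Ranking n :=
  fun i => if i ∈ S then a i else none

theorem proj_apply_of_mem {n : ℕ} (a : Ranking n) {S : Finset (Fin n)} {i : Fin n} (hi : i ∈ S) :
    proj a S i = a i := by
  simp [proj, hi]

theorem mem_ranked {n : ℕ} {a : Ranking n} {i : Fin n} : i ∈ ranked a ↔ (a i).isSome := by
  simp [ranked]

theorem ranked_proj {n : ℕ} {a : Ranking n} {S : Finset (Fin n)} (h : S ⊆ ranked a) :
    ranked (proj a S) = S := by
  ext i
  by_cases hi : i ∈ S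
  · simpa [mem_ranked, proj, hi] using mem_ranked.mp (h hi)
  · simp [mem_ranked, proj, hi]

theorem rmat_proj_of_mem {n : ℕ} (a : Ranking n) {S : Finset (Fin n)} {i j : Fin n}
    (hi : i ∈ S) (hj : j ∈ S) : rmat (proj a S) i j = rmat a i j := by
  simp only [rmat, proj_apply_of_mem a hi, proj_apply_of_mem a hj]

theorem rmat_self {n : ℕ} (a : Ranking n) (i : Fin n) : rmat a i i = 0 := by
  simp [rmat]

theorem rmat_proj_of_notMem {n : ℕ} (a : Ranking n) {S : Finset (Fin n)} {i j : Fin n}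
    (h : ¬(i ∈ S ∧ j ∈ S)) : rmat (proj a S) i j = 0 := by
  rcases not_and_or.mp h with h | h <;> simp [rmat, proj, h]

theorem rmat_eq_one_or_neg_one {n : ℕ} {a : Ranking n} {i j : Fin n}
    (hi : i ∈ ranked a) (hj : j ∈ ranked a) (hij : i ≠ j) :
    rmat a i j = 1 ∨ rmat a i j = -1 := by
  simp only [mem_ranked, Option.isSome_iff_exists] at hi hj
  obtain ⟨x, hx⟩ := hi
  obtain ⟨y, hy⟩ := hj
  by_cases h : x ≤ y <;> simp [rmat, hx, hy, hij, h]

theorem sum_rmat_proj {n : ℕ} (a b : Ranking n) (S : Finset (Fin n)) :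
    ∑ i, ∑ j, rmat (proj a S) i j * rmat (proj b S) i j =
      ∑ p ∈ S.offDiag, rmat a p.1 p.2 * rmat b p.1 p.2 := by
  rw [← Fintype.sum_prod_type' (f := fun i j => rmat (proj a S) i j * rmat (proj b S) i j)]
  symm
  refine sum_subset_zero_on_sdiff (subset_univ _) ?_ ?_
  · rintro ⟨i, j⟩ h
    by_cases hS : i ∈ S ∧ j ∈ S
    · have hij : i = j := by simpa [hS.1, hS.2] using h
      simp [hij, rmat_self]
    · simp [rmat_proj_of_notMem a hS]
  · rintro ⟨i, j⟩ h
    obtain ⟨hi, hj, -⟩ := mem_offDiag.mp h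
    simp only [rmat_proj_of_mem _ hi hj]

theorem tauHat_proj {n : ℕ} {a b : Ranking n} {S : Finset (Fin n)}
    (ha : S ⊆ ranked a) (hb : S ⊆ ranked b) :
    tauHat (proj a S) (proj b S) =
      ((∑ p ∈ S.offDiag, rmat a p.1 p.2 * rmat b p.1 p.2 : ℤ) : ℚ) /
        ((S.card : ℚ) * ((S.card : ℚ) - 1)) := by
  rw [← sum_rmat_proj]
  simp [tauHat, nbar, ranked_proj ha, ranked_proj hb]

/-- The triangle inequality, with its equality case, for a triple of signs. -/
theorem sign_triangle {x y z : ℤ} (hx : x = 1 ∨ x = -1) (hy : y = 1 ∨ y = -1)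
    (hz : z = 1 ∨ z = -1) :
    x * y + y * z ≤ x * z + 1 ∧ (x * y + y * z = x * z + 1 ↔ (x = z → y = x)) := by
  rcases hx with rfl | rfl <;> rcases hy with rfl | rfl <;> rcases hz with rfl | rfl <;> decide

/-- Axiom 5 (equality case): equality in the relaxed triangle inequality holds
iff the projection of `b` is between the projections of `a` and `c`. -/
theorem tauHat_relaxed_triangle_eq_iff_between (n : ℕ) (a b c : Ranking n)
    (W : Finset (Fin n)) (hW : W = ranked a ∩ ranked b ∩ ranked c) (hcard : 2 ≤ W.card) :
    (tauHat (proj a W) (proj b W) + tauHat (proj b W) (proj c W) =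
        tauHat (proj a W) (proj c W) + 1) ↔
      (∀ i j, i ∈ W → j ∈ W → i ≠ j → rmat a i j = rmat c i j → rmat b i j = rmat a i j) := by
  have ha : W ⊆ ranked a := fun i hi => by simp_all
  have hb : W ⊆ ranked b := fun i hi => by simp_all
  have hc : W ⊆ ranked c := fun i hi => by simp_all
  have hsign : ∀ p ∈ W.offDiag, _ := fun p hp =>
    have ⟨hi, hj, hij⟩ := mem_offDiag.mp hp
    sign_triangle (rmat_eq_one_or_neg_one (ha hi) (ha hj) hij)
      (rmat_eq_one_or_neg_one (hb hi) (hb hj) hij) (rmat_eq_one_or_neg_one (hc hi) (hc hj) hij)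
  have hcardQ : (2 : ℚ) ≤ W.card := by exact_mod_cast hcard
  have hpos : (0 : ℚ) < (W.card : ℚ) * ((W.card : ℚ) - 1) :=
    mul_pos (by linarith) (by linarith)
  have hoff : (W.card : ℚ) * ((W.card : ℚ) - 1) = ((∑ _p ∈ W.offDiag, 1 : ℤ) : ℚ) := by
    have hle : W.card ≤ W.card * W.card := Nat.le_mul_self _
    simp only [sum_const, offDiag_card, nsmul_eq_mul, mul_one]
    push_cast [Nat.cast_sub hle]
    ring
  rw [tauHat_proj ha hb, tauHat_proj hb hc, tauHat_proj ha hc, ← add_div,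
    div_add_one hpos.ne', div_left_inj' hpos.ne', hoff,
    ← Int.cast_add, ← Int.cast_add, Int.cast_inj, ← sum_add_distrib, ← sum_add_distrib,
    sum_eq_sum_iff_of_le fun p hp => (hsign p hp).1]
  constructor
  · intro h i j hi hj hij
    have hp : (i, j) ∈ W.offDiag := mem_offDiag.mpr ⟨hi, hj, hij⟩
    exact (hsign _ hp).2.mp (h _ hp)
  · intro h p hp
    obtain ⟨hi, hj, hij⟩ := mem_offDiag.mp hp
    exact (hsign p hp).2.mpr (h _ _ hi hj hij)
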